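/- arXiv:2103.00838 — 4 statements merged into one kernel-verified Lean document; each statement's English description precedes it below -/
import Mathlib

section
/- Let N, d ∈ ℕ* and let w : (ℝ^d)^N → ℝ be differentiable and exchangeable. Then there exists a D-exchangeable function z : (ℝ^d)^N × ℝ^d → ℝ^d, i.e. such that for each fixed x ∈ ℝ^d the map x ↦ z(x, x) is exchangeable on (ℝ^d)^N, satisfying D_{x_i} w(x) = z(x, x_i) for every x = (x_1,…,x_N) ∈ (ℝ^d)^N and every i ∈ {1,…,N}. -/
/-- The gradient of `w : (ℝ^d)^N → ℝ` with respect to its `i`-th `ℝ^d`-block at `x`. -/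
noncomputable def blockGrad {N d : ℕ} (w : (Fin N → Fin d → ℝ) → ℝ)
    (x : Fin N → Fin d → ℝ) (i : Fin N) : Fin d → ℝ :=
  fun a => fderiv ℝ w x (Pi.single i (Pi.single a 1))

theorem blockGrad_perm_aux {N d : ℕ} (w : (Fin N → Fin d → ℝ) → ℝ)
    (hdiff : Differentiable ℝ w)
    (hexch : ∀ (π : Equiv.Perm (Fin N)) (x : Fin N → Fin d → ℝ),
      w (fun i => x (π i)) = w x) (π : Equiv.Perm (Fin N)) (x : Fin N → Fin d → ℝ)
    (j : Fin N) : blockGrad w (fun i => x (π i)) j = blockGrad w x (π j) := by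
  let L : (Fin N → Fin d → ℝ) →L[ℝ] (Fin N → Fin d → ℝ) :=
    ContinuousLinearMap.pi fun i => ContinuousLinearMap.proj (π i)
  have hL : ∀ y, L y = fun i => y (π i) := fun y => rfl
  have h1 : HasFDerivAt (fun y => w (L y)) ((fderiv ℝ w (L x)).comp L) x :=
    (hdiff (L x)).hasFDerivAt.comp x L.hasFDerivAt
  have h2 : (fun y => w (L y)) = w := by
    funext y
    rw [hL]
    exact hexch π y
  rw [h2] at h1
  funext a
  unfold blockGrad
  rw [h1.fderiv, ContinuousLinearMap.comp_apply, ← hL x]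
  congr 1
  rw [hL]
  funext k
  by_cases hk : k = j
  · subst hk
    simp
  · have : π k ≠ π j := fun h => hk (π.injective h)
    rw [Pi.single_eq_of_ne hk, Pi.single_eq_of_ne this]

/-- If `w : (ℝ^d)^N → ℝ` is differentiable and exchangeable, then there is a
D-exchangeable function `z : (ℝ^d)^N × ℝ^d → ℝ^d` such that `D_{x_i} w(x) = z(x, x_i)`
for all `x` and `i`. -/
theorem exists_D_exchangeable_gradient_representation
    {N d : ℕ} (hN : 0 < N) (hd : 0 < d)
    (w : (Fin N → Fin d → ℝ) → ℝ)
    (hdiff : Differentiable ℝ w)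
    (hexch : ∀ (π : Equiv.Perm (Fin N)) (x : Fin N → Fin d → ℝ),
      w (fun i => x (π i)) = w x) :
    ∃ z : (Fin N → Fin d → ℝ) → (Fin d → ℝ) → (Fin d → ℝ),
      -- z is D-exchangeable:
      (∀ (v : Fin d → ℝ) (π : Equiv.Perm (Fin N)) (x : Fin N → Fin d → ℝ),
        z (fun i => x (π i)) v = z x v) ∧
      -- z represents all the partial gradients of w:
      (∀ (x : Fin N → Fin d → ℝ) (i : Fin N), blockGrad w x i = z x (x i)) := by
  classical
  have key := blockGrad_perm_aux w hdiff hexch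
  have same : ∀ (x : Fin N → Fin d → ℝ) (i j : Fin N), x i = x j →
      blockGrad w x i = blockGrad w x j := by
    intro x i j hij
    have h := key (Equiv.swap i j) x i
    have hx : (fun k => x (Equiv.swap i j k)) = x := by
      funext k
      rw [Equiv.swap_apply_def]
      split_ifs with h1 h2
      · rw [h1, hij]
      · rw [h2, hij]
      · rfl
    rw [hx, Equiv.swap_apply_left] at h
    exact h
  refine ⟨fun x v => if h : ∃ i, x i = v then blockGrad w x h.choose else 0, ?_, ?_⟩
  · intro v π x
    by_cases h : ∃ i, x i = v
    · have h' : ∃ i, x (π i) = v := by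
        obtain ⟨i, hi⟩ := h
        exact ⟨π.symm i, by simpa using hi⟩
      simp only [dif_pos h, dif_pos h']
      rw [key]
      exact same x _ _ (h'.choose_spec.trans h.choose_spec.symm)
    · have h' : ¬ ∃ i, x (π i) = v := fun ⟨i, hi⟩ => h ⟨π i, hi⟩
      simp only [dif_neg h, dif_neg h']
  · intro x i
    have h : ∃ k, x k = x i := ⟨i, rfl⟩
    simp only [dif_pos h]
    exact same x _ _ h.choose_spec.symm
end

section
/- Universal approximation by PointNet (one-dimensional inputs): let ρ : ℝ → ℝ be continuous, bounded and non-constant, let d', N ∈ ℕ*, let K ⊂ ℝ be compact, and let w be a real-valued (ℝ^{d'}-valued) function on nonempty subsets of K with at most N elements that is continuous with respect to the Hausdorff distance. Then for every ε > 0 there exist k ∈ ℕ* and feedforward neural networks with activation ρ, φ : ℝ → ℝ^k and ψ : ℝ^k → ℝ^{d'}, such that |w({x_1,…,x_N}) − ψ( max_{1 ≤ i ≤ N} φ(x_i) )| ≤ ε for all (x_1,…,x_N) ∈ K^N, where the maximum over i is taken componentwise in ℝ^k. -/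
/-- `f : ℝ^n → ℝ^m` is an affine map. -/
def IsAffineMap {n m : ℕ} (f : (Fin n → ℝ) → (Fin m → ℝ)) : Prop :=
  ∃ (A : Matrix (Fin m) (Fin n) ℝ) (b : Fin m → ℝ), ∀ x, f x = A.mulVec x + b

/-- Functions of the form `(ρ ∘ A_k) ∘ ⋯ ∘ (ρ ∘ A_0)` with `A_i` affine and the
activation `ρ` applied componentwise. -/
inductive IsHiddenStack (ρ : ℝ → ℝ) : ∀ n m : ℕ, ((Fin n → ℝ) → (Fin m → ℝ)) → Prop
  | base {n m : ℕ} (f : (Fin n → ℝ) → (Fin m → ℝ)) (hf : IsAffineMap f) :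
      IsHiddenStack ρ n m (fun x i => ρ (f x i))
  | comp {n k m : ℕ} (g : (Fin n → ℝ) → (Fin k → ℝ)) (hg : IsHiddenStack ρ n k g)
      (f : (Fin k → ℝ) → (Fin m → ℝ)) (hf : IsAffineMap f) :
      IsHiddenStack ρ n m (fun x i => ρ (f (g x) i))

/-- A feedforward neural network with activation `ρ`: a function of the form
`A_ℓ ∘ (ρ ∘ A_{ℓ-1}) ∘ ⋯ ∘ (ρ ∘ A_0)` with `ℓ ≥ 1` and the `A_i` affine. -/
def IsNeuralNet (ρ : ℝ → ℝ) (n m : ℕ) (F : (Fin n → ℝ) → (Fin m → ℝ)) : Prop :=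
  ∃ (k : ℕ) (g : (Fin n → ℝ) → (Fin k → ℝ)) (f : (Fin k → ℝ) → (Fin m → ℝ)),
    IsHiddenStack ρ n k g ∧ IsAffineMap f ∧ ∀ x, F x = f (g x)

open scoped Convolution Topology ContDiff
open MeasureTheory Filter

/-- One-dimensional neuron restricted to an interval. -/
noncomputable def pnRidge (f : ℝ → ℝ) (hf : Continuous f) (R a b : ℝ) :
    C(Set.Icc (-R) R, ℝ) := ⟨fun x => f (a * x + b), by fun_prop⟩

noncomputable def pnW (f : ℝ → ℝ) (hf : Continuous f) (R : ℝ) :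
    Submodule ℝ C(Set.Icc (-R) R, ℝ) :=
  (Submodule.span ℝ (Set.range fun p : ℝ × ℝ => pnRidge f hf R p.1 p.2)).topologicalClosure

lemma pn_integral_mem {E : Type*} [NormedAddCommGroup E] [NormedSpace ℝ E] [CompleteSpace E]
    (W : Submodule ℝ E) (hW : IsClosed (W : Set E)) (g : ℝ → E) (hg : Continuous g)
    (hc : HasCompactSupport g) (h : ∀ t, g t ∈ W) : ∫ t, g t ∈ W := by
  have : CompleteSpace W := hW.completeSpace_coe
  have hg' : Continuous (fun t => (⟨g t, h t⟩ : W)) := hg.subtype_mk _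
  have hc' : HasCompactSupport (fun t => (⟨g t, h t⟩ : W)) := by
    refine hc.mono ?_
    intro t ht
    simp only [Function.mem_support, ne_eq] at ht ⊢
    intro h0
    exact ht (Subtype.ext h0)
  have := W.subtypeL.integral_comp_comm (hg'.integrable_of_hasCompactSupport hc' (μ := volume))
  simp only [Submodule.subtypeL_apply] at this
  rw [this]
  exact Subtype.mem _

lemma pn_curry_cont {X : Type*} [TopologicalSpace X] (G : ℝ → X → ℝ)
    (hG : Continuous (fun p : ℝ × X => G p.1 p.2)) (hG' : ∀ a, Continuous (G a)) :
    Continuous (fun a => (⟨G a, hG' a⟩ : C(X, ℝ))) :=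
  (ContinuousMap.curry ⟨_, hG⟩).continuous

lemma pn_deriv_mem {E : Type*} [NormedAddCommGroup E] [NormedSpace ℝ E]
    (W : Submodule ℝ E) (hW : IsClosed (W : Set E)) (g : ℝ → E) (g' : E) (a : ℝ)
    (hg : HasDerivAt g g' a) (h : ∀ t, g t ∈ W) : g' ∈ W := by
  rw [hasDerivAt_iff_tendsto_slope] at hg
  refine hW.mem_of_tendsto hg (Eventually.of_forall fun t => ?_)
  exact W.smul_mem _ (W.sub_mem (h _) (h _))

lemma pn_hasDeriv {X : Type*} [TopologicalSpace X] [CompactSpace X] (G G' : ℝ → X → ℝ)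
    (hG : ∀ a, Continuous (G a))
    (hG' : Continuous (fun p : ℝ × X => G' p.1 p.2)) (hG'1 : ∀ a, Continuous (G' a))
    (hd : ∀ a x, HasDerivAt (fun s => G s x) (G' a x) a) (a : ℝ) :
    HasDerivAt (fun a => (⟨G a, hG a⟩ : C(X, ℝ))) ⟨G' a, hG'1 a⟩ a := by
  have hc := pn_curry_cont G' hG' hG'1
  have key : (fun s => (⟨G s, hG s⟩ : C(X, ℝ))) = fun s => (⟨G a, hG a⟩ : C(X, ℝ)) +
      ∫ t in a..s, (⟨G' t, hG'1 t⟩ : C(X, ℝ)) := by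
    funext s
    ext x
    have h1 := (ContinuousMap.evalCLM ℝ x : C(X, ℝ) →L[ℝ] ℝ).intervalIntegral_comp_comm
      (hc.intervalIntegrable (μ := volume) a s)
    have h2 : ∫ t in a..s, G' t x = G s x - G a x := by
      refine intervalIntegral.integral_eq_sub_of_hasDerivAt (fun t _ => hd t x) ?_
      refine Continuous.intervalIntegrable ?_ _ _
      exact hG'.comp (by fun_prop : Continuous fun t : ℝ => (t, x))
    simp only [ContinuousMap.add_apply, ContinuousMap.coe_mk]
    simp only [ContinuousMap.evalCLM_apply, ContinuousMap.coe_mk] at h1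
    rw [← h1, h2]; ring
  rw [key]
  have := intervalIntegral.integral_hasDerivAt_right
    (hc.intervalIntegrable (μ := volume) a a) (hc.stronglyMeasurableAtFilter _ _) hc.continuousAt
  exact this.const_add _

lemma pn_moll_mem (ρ : ℝ → ℝ) (hρ : Continuous ρ) (R : ℝ) (φ : ContDiffBump (0:ℝ))
    (hf : Continuous (φ.normed volume ⋆[ContinuousLinearMap.lsmul ℝ ℝ, volume] ρ)) (a b : ℝ) :
    pnRidge _ hf R a b ∈ pnW ρ hρ R := by
  have h0 : ∀ t, φ.normed volume t • pnRidge ρ hρ R a (b - t) ∈ pnW ρ hρ R := fun t =>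
    Submodule.smul_mem _ _ (Submodule.le_topologicalClosure _ (Submodule.subset_span ⟨(a, b - t), rfl⟩))
  have hc : Continuous (fun t => φ.normed volume t • pnRidge ρ hρ R a (b - t)) := by
    refine φ.continuous_normed.smul ?_
    exact pn_curry_cont (fun t (x : Set.Icc (-R) R) => ρ (a * x + (b - t))) (by fun_prop) _
  have hs : HasCompactSupport (fun t => φ.normed volume t • pnRidge ρ hρ R a (b - t)) :=
    φ.hasCompactSupport_normed.smul_right
  have := pn_integral_mem _ (Submodule.isClosed_topologicalClosure _) _ hc hs h0
  suffices heq : pnRidge _ hf R a b = ∫ t, φ.normed volume t • pnRidge ρ hρ R a (b - t) by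
    rw [heq]; exact this
  ext x
  have h1 := (ContinuousMap.evalCLM ℝ x : C(Set.Icc (-R) R, ℝ) →L[ℝ] ℝ).integral_comp_comm
      (hc.integrable_of_hasCompactSupport hs (μ := volume))
  simp only [ContinuousMap.evalCLM_apply] at h1
  rw [← h1]
  simp only [pnRidge, ContinuousMap.coe_mk, convolution_def, ContinuousMap.smul_apply,
    ContinuousLinearMap.lsmul_apply, add_sub_assoc]

lemma pn_iter_mem (R : ℝ) (W : Submodule ℝ C(Set.Icc (-R) R, ℝ))
    (hW : IsClosed (W : Set C(Set.Icc (-R) R, ℝ))) (f : ℝ → ℝ) (hf : ContDiff ℝ ∞ f)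
    (hk : ∀ k, Continuous (iteratedDeriv k f))
    (h : ∀ a b, pnRidge f hf.continuous R a b ∈ W) (k : ℕ) : ∀ a b,
    (⟨fun x => (x:ℝ) ^ k * iteratedDeriv k f (a * x + b), by have := hk k; fun_prop⟩ :
      C(Set.Icc (-R) R, ℝ)) ∈ W := by
  induction k with
  | zero => intro a b; simpa [pnRidge] using h a b
  | succ k ih =>
    intro a b
    refine pn_deriv_mem W hW _ _ a (pn_hasDeriv
      (fun a (x : Set.Icc (-R) R) => (x:ℝ) ^ k * iteratedDeriv k f (a * x + b))
      (fun a (x : Set.Icc (-R) R) => (x:ℝ) ^ (k+1) * iteratedDeriv (k+1) f (a * x + b))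
      ?_ ?_ ?_ ?_ a) (fun t => ih t b)
    · intro a; have := hk k; fun_prop
    · have := hk (k+1); fun_prop
    · intro a; have := hk (k+1); fun_prop
    · intro a x
      have hd : DifferentiableAt ℝ (iteratedDeriv k f) (a * x + b) :=
        (hf.differentiable_iteratedDeriv k (by exact_mod_cast ENat.natCast_lt_top k)) _
      have h1 : HasDerivAt (fun s : ℝ => s * (x:ℝ) + b) (x:ℝ) a := by
        simpa using ((hasDerivAt_id a).mul_const (x:ℝ)).add_const b
      have h2 := (hd.hasDerivAt.scomp a h1).const_mul ((x:ℝ)^k)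
      rw [iteratedDeriv_succ]
      refine HasDerivAt.congr_deriv h2 ?_
      simp only [smul_eq_mul]; ring

lemma pn_poly_of_iter (k : ℕ) : ∀ (f : ℝ → ℝ), ContDiff ℝ ∞ f → (∀ x, iteratedDeriv k f x = 0) →
    ∃ p : Polynomial ℝ, ∀ x, f x = p.eval x := by
  induction k with
  | zero => intro f _ h; exact ⟨0, by simpa using h⟩
  | succ k ih =>
    intro f hf h
    obtain ⟨p, hp⟩ := ih (deriv f) (by
      have : ContDiff ℝ (∞ + 1) f := by simpa using hf
      exact (contDiff_succ_iff_deriv.1 this).2.2) (by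
        intro x; rw [← iteratedDeriv_succ']; exact h x)
    obtain ⟨q, hq⟩ : ∃ q : Polynomial ℝ, Polynomial.derivative q = p := by
      clear hp
      induction p using Polynomial.induction_on' with
      | add p q hp hq =>
        obtain ⟨p', hp⟩ := hp
        obtain ⟨q', hq⟩ := hq
        exact ⟨p' + q', by simp [hp, hq]⟩
      | monomial n a =>
        refine ⟨Polynomial.monomial (n+1) (a / (n+1)), ?_⟩
        rw [Polynomial.derivative_monomial]
        congr 1
        push_cast; field_simp
    have hfd : Differentiable ℝ f := hf.differentiable (by simp)
    have := is_const_of_deriv_eq_zero (f := fun x => f x - q.eval x)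
      (hfd.sub q.differentiable) (by
        intro x
        rw [deriv_fun_sub (hfd x) q.differentiableAt, hp, Polynomial.deriv, hq, sub_self])
    refine ⟨q + Polynomial.C (f 0 - q.eval 0), fun x => ?_⟩
    have := this x 0
    simp only [Polynomial.eval_add, Polynomial.eval_C]
    linarith

lemma pn_bdd_poly (p : Polynomial ℝ) (C : ℝ) (h : ∀ x, |p.eval x| ≤ C) (x y : ℝ) :
    p.eval x = p.eval y := by
  have : p.degree ≤ 0 := by
    rw [← Polynomial.isBoundedUnder_abs_atTop_iff]
    exact ⟨C, eventually_map.2 (Eventually.of_forall h)⟩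
  rw [Polynomial.eq_C_of_degree_le_zero this]; simp

lemma pn_W_top (ρ : ℝ → ℝ) (hρ : Continuous ρ) (hb : ∃ C, ∀ x, |ρ x| ≤ C)
    (hn : ∃ x y, ρ x ≠ ρ y) (R : ℝ) : pnW ρ hρ R = ⊤ := by
  obtain ⟨C, hC⟩ := hb
  obtain ⟨x, y, hxy⟩ := hn
  -- a smooth bounded nonconstant function
  obtain ⟨f, hf, hfb, hfn, hfW⟩ : ∃ f : ℝ → ℝ, ∃ hf : ContDiff ℝ ∞ f, (∃ C, ∀ x, |f x| ≤ C) ∧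
      f x ≠ f y ∧ ∀ a b, pnRidge f hf.continuous R a b ∈ pnW ρ hρ R := by
    have hpos : 0 < |ρ x - ρ y| / 3 := by
      have := abs_pos.2 (sub_ne_zero.2 hxy); positivity
    obtain ⟨δ1, h1, hx⟩ := Metric.continuous_iff.1 hρ x _ hpos
    obtain ⟨δ2, h2, hy⟩ := Metric.continuous_iff.1 hρ y _ hpos
    have hm : 0 < min δ1 δ2 := lt_min h1 h2
    let φ : ContDiffBump (0:ℝ) := ⟨min δ1 δ2 / 2, min δ1 δ2, by linarith, by linarith⟩
    have hsm : ContDiff ℝ ∞ (φ.normed volume ⋆[ContinuousLinearMap.lsmul ℝ ℝ, volume] ρ) :=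
      φ.hasCompactSupport_normed.contDiff_convolution_left _ φ.contDiff_normed
        hρ.locallyIntegrable
    refine ⟨_, hsm, ⟨C + 2 * C, fun z => ?_⟩, ?_, fun a b => pn_moll_mem ρ hρ R φ _ a b⟩
    · have := φ.dist_normed_convolution_le (μ := volume) (x₀ := z) (ε := 2 * C)
        hρ.aestronglyMeasurable (fun t _ => by
          rw [Real.dist_eq]
          have := abs_sub (ρ t) (ρ z)
          linarith [hC t, hC z])
      rw [Real.dist_eq] at this
      have h3 := abs_sub_abs_le_abs_sub
        ((φ.normed volume ⋆[ContinuousLinearMap.lsmul ℝ ℝ, volume] ρ) z) (ρ z)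
      linarith [hC z]
    · intro heq
      have e1 := φ.dist_normed_convolution_le (μ := volume) (x₀ := x)
        hρ.aestronglyMeasurable (fun t ht => (hx t (lt_of_lt_of_le ht (min_le_left _ _))).le)
      have e2 := φ.dist_normed_convolution_le (μ := volume) (x₀ := y)
        hρ.aestronglyMeasurable (fun t ht => (hy t (lt_of_lt_of_le ht (min_le_right _ _))).le)
      rw [heq, dist_comm] at e1
      have := dist_triangle (ρ x) _ (ρ y) |>.trans (add_le_add e1 e2)
      rw [Real.dist_eq] at this
      linarith
  have hmono : ∀ k : ℕ, (⟨fun x => (x:ℝ)^k, by fun_prop⟩ : C(Set.Icc (-R) R, ℝ)) ∈ pnW ρ hρ R := by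
    intro k
    have : ∃ b, iteratedDeriv k f b ≠ 0 := by
      by_contra! h
      obtain ⟨p, hp⟩ := pn_poly_of_iter k f hf h
      obtain ⟨C', hC'⟩ := hfb
      apply hfn
      rw [hp, hp]
      exact pn_bdd_poly p C' (fun x => by rw [← hp]; exact hC' x) x y
    obtain ⟨b, hb⟩ := this
    have := pn_iter_mem R (pnW ρ hρ R) (Submodule.isClosed_topologicalClosure _) f hf
      (fun k => hf.continuous_iteratedDeriv k (by exact_mod_cast le_top)) hfW k 0 b
    have := Submodule.smul_mem _ (iteratedDeriv k f b)⁻¹ this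
    convert this using 1
    ext x
    simp
    field_simp
  have hpoly : (polynomialFunctions (Set.Icc (-R) R) : Set C(Set.Icc (-R) R, ℝ)) ⊆ pnW ρ hρ R := by
    rintro g ⟨p, -, rfl⟩
    simp only [SetLike.mem_coe]
    induction p using Polynomial.induction_on' with
    | add p q hp hq => rw [map_add]; exact Submodule.add_mem _ hp hq
    | monomial n a =>
      convert Submodule.smul_mem _ a (hmono n) using 1
      ext x; simp
  have htop := polynomialFunctions_closure_eq_top (-R) R
  rw [eq_top_iff]
  intro g _
  have hg : g ∈ (polynomialFunctions (Set.Icc (-R) R)).topologicalClosure := by rw [htop]; trivial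
  exact closure_minimal hpoly (Submodule.isClosed_topologicalClosure _) hg

lemma pn_dot_cont {n : ℕ} (X : Set (Fin n → ℝ)) (a : Fin n → ℝ) :
    Continuous fun x : X => a ⬝ᵥ x.1 :=
  continuous_finset_sum _ fun i _ =>
    continuous_const.mul ((continuous_apply i).comp continuous_subtype_val)

/-- Multi-dimensional neuron restricted to a set. -/
noncomputable def pnRidgeN {n : ℕ} (f : ℝ → ℝ) (hf : Continuous f) (X : Set (Fin n → ℝ))
    (p : (Fin n → ℝ) × ℝ) : C(X, ℝ) := ⟨fun x => f (p.1 ⬝ᵥ x.1 + p.2), by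
      have : Continuous fun x : X => p.1 ⬝ᵥ x.1 := pn_dot_cont X p.1
      fun_prop⟩

lemma pn_exp_mem {n : ℕ} (ρ : ℝ → ℝ) (hρ : Continuous ρ) (hb : ∃ C, ∀ x, |ρ x| ≤ C)
    (hn : ∃ x y, ρ x ≠ ρ y) (X : Set (Fin n → ℝ)) [CompactSpace X] (a : Fin n → ℝ) :
    pnRidgeN Real.exp Real.continuous_exp X (a, 0) ∈
      (Submodule.span ℝ (Set.range (pnRidgeN ρ hρ X))).topologicalClosure := by
  have hl : Continuous fun x : X => a ⬝ᵥ x.1 := pn_dot_cont X a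
  obtain ⟨R, hR⟩ : ∃ R : ℝ, ∀ x : X, |a ⬝ᵥ x.1| ≤ R := by
    obtain ⟨R, hR⟩ := (isCompact_range hl).isBounded.exists_norm_le
    exact ⟨R, fun x => hR _ ⟨x, rfl⟩⟩
  let l : C(X, Set.Icc (-R) R) := ⟨fun x => ⟨a ⬝ᵥ x.1, abs_le.1 (hR x)⟩, hl.subtype_mk _⟩
  let L := (ContinuousMap.compRightAlgHom ℝ ℝ l)
  have hL : Continuous L := ContinuousMap.compRightAlgHom_continuous ℝ ℝ l
  have hmem : pnRidge Real.exp Real.continuous_exp R 1 0 ∈ pnW ρ hρ R := by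
    rw [pn_W_top ρ hρ hb hn R]; trivial
  have hle : pnW ρ hρ R ≤ ((Submodule.span ℝ (Set.range (pnRidgeN ρ hρ X))).topologicalClosure).comap
      L.toLinearMap := by
    refine Submodule.topologicalClosure_minimal _ ?_ ?_
    · rw [Submodule.span_le]
      rintro _ ⟨⟨s, b⟩, rfl⟩
      refine Submodule.le_topologicalClosure _ (Submodule.subset_span ⟨(s • a, b), ?_⟩)
      ext x
      simp [L, l, pnRidgeN, pnRidge]
    · exact (Submodule.isClosed_topologicalClosure _).preimage hL
  have h2 := hle hmem
  have h3 : L.toLinearMap (pnRidge Real.exp Real.continuous_exp R 1 0) =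
      pnRidgeN Real.exp Real.continuous_exp X (a, 0) := by
    ext x
    simp [L, l, pnRidgeN, pnRidge]
  rw [← h3]; exact h2

lemma pn_dense {n : ℕ} (ρ : ℝ → ℝ) (hρ : Continuous ρ) (hb : ∃ C, ∀ x, |ρ x| ≤ C)
    (hn : ∃ x y, ρ x ≠ ρ y) (X : Set (Fin n → ℝ)) [CompactSpace X] :
    (Submodule.span ℝ (Set.range (pnRidgeN ρ hρ X))).topologicalClosure = ⊤ := by
  let M : Submonoid C(X, ℝ) :=
    { carrier := Set.range fun a => pnRidgeN Real.exp Real.continuous_exp X (a, 0)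
      one_mem' := ⟨0, by ext x; simp [pnRidgeN]⟩
      mul_mem' := by
        rintro _ _ ⟨a, rfl⟩ ⟨b, rfl⟩
        exact ⟨a + b, by ext x; simp [pnRidgeN, add_dotProduct, Real.exp_add]⟩ }
  let A : Subalgebra ℝ C(X, ℝ) := Algebra.adjoin ℝ (M : Set C(X, ℝ))
  have hA : A.topologicalClosure = ⊤ := by
    refine ContinuousMap.subalgebra_topologicalClosure_eq_top_of_separatesPoints A ?_
    intro x y hxy
    obtain ⟨i, hi⟩ : ∃ i, x.1 i ≠ y.1 i := by
      by_contra! h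
      exact hxy (Subtype.ext (funext h))
    refine ⟨_, ⟨pnRidgeN Real.exp Real.continuous_exp X (Pi.single i 1, 0),
      Algebra.subset_adjoin ⟨_, rfl⟩, rfl⟩, ?_⟩
    simpa [pnRidgeN] using hi
  have hAW : (A : Set C(X, ℝ)) ⊆
      (Submodule.span ℝ (Set.range (pnRidgeN ρ hρ X))).topologicalClosure := by
    have h1 : Subalgebra.toSubmodule A = Submodule.span ℝ (M : Set C(X, ℝ)) := by
      rw [Algebra.adjoin_eq_span, Submonoid.closure_eq]
    have h2 : Subalgebra.toSubmodule A ≤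
      (Submodule.span ℝ (Set.range (pnRidgeN ρ hρ X))).topologicalClosure := by
      rw [h1, Submodule.span_le]
      rintro _ ⟨a, rfl⟩
      exact pn_exp_mem ρ hρ hb hn X a
    exact h2
  rw [eq_top_iff]
  intro g _
  have hg : g ∈ A.topologicalClosure := by rw [hA]; trivial
  exact closure_minimal hAW (Submodule.isClosed_topologicalClosure _) hg

lemma pn_uat {n d : ℕ} (ρ : ℝ → ℝ) (hρ : Continuous ρ) (hb : ∃ C, ∀ x, |ρ x| ≤ C)
    (hn : ∃ x y, ρ x ≠ ρ y) (X : Set (Fin n → ℝ)) (hX : IsCompact X)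
    (F : (Fin n → ℝ) → (Fin d → ℝ)) (hF : Continuous F) (ε : ℝ) (hε : 0 < ε) :
    ∃ G, IsNeuralNet ρ n d G ∧ ∀ x ∈ X, ∀ j, |F x j - G x j| ≤ ε := by
  classical
  have : CompactSpace X := isCompact_iff_compactSpace.1 hX
  have key : ∀ j : Fin d, ∃ c : ((Fin n → ℝ) × ℝ) →₀ ℝ, ∀ x ∈ X,
      |F x j - c.sum (fun p s => s * ρ (p.1 ⬝ᵥ x + p.2))| ≤ ε := by
    intro j
    let f : C(X, ℝ) := ⟨fun x => F x.1 j, by fun_prop⟩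
    have hf : f ∈ (Submodule.span ℝ (Set.range (pnRidgeN ρ hρ X))).topologicalClosure := by
      rw [pn_dense ρ hρ hb hn X]; trivial
    obtain ⟨g, hg, hfg⟩ := Metric.mem_closure_iff.1 hf ε hε
    obtain ⟨c, rfl⟩ := Finsupp.mem_span_range_iff_exists_finsupp.1 hg
    refine ⟨c, fun x hx => ?_⟩
    have := (ContinuousMap.dist_apply_le_dist (f := f) (⟨x, hx⟩ : X)).trans hfg.le
    rw [Real.dist_eq] at this
    have heq : c.sum (fun p s => s * ρ (p.1 ⬝ᵥ x + p.2)) =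
        (c.sum fun i a => a • pnRidgeN ρ hρ X i) ⟨x, hx⟩ := by
      simp [Finsupp.sum, pnRidgeN, ContinuousMap.sum_apply]
    rw [heq]; exact this
  choose c hc using key
  let T : Finset ((Fin n → ℝ) × ℝ) := Finset.univ.biUnion fun j => (c j).support
  let e : Fin (Fintype.card T) ≃ T := (Fintype.equivFin T).symm
  let A0 : Matrix (Fin (Fintype.card T)) (Fin n) ℝ := Matrix.of fun i => (e i).1.1
  let b0 : Fin (Fintype.card T) → ℝ := fun i => (e i).1.2
  let A1 : Matrix (Fin d) (Fin (Fintype.card T)) ℝ := Matrix.of fun j i => c j (e i).1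
  refine ⟨fun x => A1.mulVec (fun i => ρ ((A0.mulVec x + b0) i)) + 0, ⟨_, _, fun y => A1.mulVec y + 0,
    IsHiddenStack.base (fun x => A0.mulVec x + b0) ⟨A0, b0, fun x => rfl⟩,
    ⟨A1, 0, fun x => rfl⟩, fun x => rfl⟩, fun x hx j => ?_⟩
  convert hc j x hx using 3
  rw [Finsupp.sum_of_support_subset (c j) (s := T)
    (Finset.subset_biUnion_of_mem (fun j => (c j).support) (Finset.mem_univ j)) _ (by simp)]
  rw [← Finset.sum_coe_sort T, ← e.sum_comp]
  simp [A1, A0, b0, Matrix.mulVec, dotProduct]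

lemma pn_range_cont {N : ℕ} (hN : 0 < N) : Continuous (fun x : Fin N → ℝ =>
    (⟨⟨Set.range x, (Set.finite_range x).isCompact⟩, ⟨x ⟨0, hN⟩, ⟨⟨0, hN⟩, rfl⟩⟩⟩ :
      TopologicalSpace.NonemptyCompacts ℝ)) := by
  refine LipschitzWith.continuous (K := 1) (LipschitzWith.of_dist_le_mul fun x y => ?_)
  rw [Metric.NonemptyCompacts.dist_eq, NNReal.coe_one, one_mul]
  refine Metric.hausdorffDist_le_of_mem_dist dist_nonneg ?_ ?_
  · rintro _ ⟨i, rfl⟩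
    exact ⟨y i, ⟨i, rfl⟩, dist_le_pi_dist x y i⟩
  · rintro _ ⟨i, rfl⟩
    exact ⟨x i, ⟨i, rfl⟩, by rw [dist_comm]; exact dist_le_pi_dist x y i⟩

lemma pn_sup {N : ℕ} (hN : 0 < N) (x : Fin N → ℝ) (y : ℝ) :
    Metric.infDist y (Set.range x) = - ⨆ i, -|x i - y| := by
  have : Nonempty (Fin N) := ⟨⟨0, hN⟩⟩
  rw [Metric.infDist_eq_iInf]
  have h1 : (⨅ z : Set.range x, dist y z) = ⨅ i, |x i - y| := by
    rw [iInf_range' (f := x) (g := fun z => dist y z)]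
    simp [Real.dist_eq, abs_sub_comm]
  rw [h1, iInf, Real.sInf_def, iSup]
  congr 2
  ext z
  simp only [Set.mem_neg, Set.mem_range]
  exact exists_congr fun i => ⟨fun h => by linarith, fun h => by linarith⟩

lemma pn_sup_close {N : ℕ} (hN : 0 < N) (f g : Fin N → ℝ) (δ : ℝ) (h : ∀ i, |f i - g i| ≤ δ) :
    |(⨆ i, f i) - ⨆ i, g i| ≤ δ := by
  have : Nonempty (Fin N) := ⟨⟨0, hN⟩⟩
  have hf := (Set.finite_range f).bddAbove
  have hg := (Set.finite_range g).bddAbove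
  rw [abs_sub_le_iff]
  constructor
  · rw [sub_le_iff_le_add]
    exact ciSup_le fun i => by
      have := le_ciSup hg i
      linarith [(abs_sub_le_iff.1 (h i)).1]
  · rw [sub_le_iff_le_add]
    exact ciSup_le fun i => by
      have := le_ciSup hf i
      linarith [(abs_sub_le_iff.1 (h i)).2]

/-- First step: exact continuous encoder and decoder. -/
lemma pn_step {d' N : ℕ} (hN : 0 < N) (K : Set ℝ) (hK : IsCompact K)
    (w : TopologicalSpace.NonemptyCompacts ℝ → (Fin d' → ℝ))
    (hw : ContinuousOn w
      {S : TopologicalSpace.NonemptyCompacts ℝ | (S : Set ℝ) ⊆ K ∧ (S : Set ℝ).ncard ≤ N})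
    (ε : ℝ) (hε : 0 < ε) :
    ∃ (k : ℕ) (_ : 0 < k) (y : Fin k → ℝ) (P : (Fin k → ℝ) → (Fin d' → ℝ)), Continuous P ∧
      ∀ x : Fin N → ℝ, (∀ i, x i ∈ K) → ∀ j,
          |w ⟨⟨Set.range x, (Set.finite_range x).isCompact⟩,
                ⟨x ⟨0, hN⟩, ⟨⟨0, hN⟩, rfl⟩⟩⟩ j
            - P (fun c => ⨆ i, -|x i - y c|) j| ≤ ε := by
  classical
  let r : (Fin N → ℝ) → TopologicalSpace.NonemptyCompacts ℝ := fun x =>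
    ⟨⟨Set.range x, (Set.finite_range x).isCompact⟩, ⟨x ⟨0, hN⟩, ⟨⟨0, hN⟩, rfl⟩⟩⟩
  have hr : Continuous r := pn_range_cont hN
  let X : Set (TopologicalSpace.NonemptyCompacts ℝ) := r '' (Set.univ.pi fun _ => K)
  have hX : IsCompact X := (isCompact_univ_pi fun _ => hK).image hr
  have : CompactSpace X := isCompact_iff_compactSpace.1 hX
  have hwX : ContinuousOn w X := hw.mono (by
    rintro _ ⟨x, hx, rfl⟩
    constructor
    · rintro _ ⟨i, rfl⟩
      exact hx i trivial
    · change (Set.range x).ncard ≤ N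
      rw [← Set.image_univ]
      refine (Set.ncard_image_le).trans ?_
      simp)
  let D : ℝ → C(X, ℝ) := fun y => ⟨fun S => - Metric.infDist y (S.1 : Set ℝ),
    ((Metric.lipschitz_infDist_set y).continuous.comp continuous_subtype_val).neg⟩
  let A : Subalgebra ℝ C(X, ℝ) := Algebra.adjoin ℝ (Set.range D)
  have hsep : ∀ S T : TopologicalSpace.NonemptyCompacts ℝ, ¬ (S : Set ℝ) ⊆ T →
      ∃ y, Metric.infDist y (S : Set ℝ) ≠ Metric.infDist y (T : Set ℝ) := by
    intro S T h
    obtain ⟨y, hyS, hyT⟩ := Set.not_subset.1 h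
    refine ⟨y, ?_⟩
    rw [Metric.infDist_zero_of_mem hyS]
    exact ((T.isCompact.isClosed.notMem_iff_infDist_pos T.nonempty).1 hyT).ne
  have hA : A.topologicalClosure = ⊤ := by
    refine ContinuousMap.subalgebra_topologicalClosure_eq_top_of_separatesPoints A ?_
    intro S T hST
    obtain ⟨y, hy⟩ : ∃ y, Metric.infDist y (S.1 : Set ℝ) ≠ Metric.infDist y (T.1 : Set ℝ) := by
      by_cases h : (S.1 : Set ℝ) ⊆ T.1
      · obtain ⟨y, hy⟩ := hsep T.1 S.1 (fun h' => hST (Subtype.ext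
          (SetLike.coe_injective (h.antisymm h'))))
        exact ⟨y, hy.symm⟩
      · exact hsep _ _ h
    refine ⟨_, ⟨D y, Algebra.subset_adjoin ⟨_, rfl⟩, rfl⟩, ?_⟩
    simpa [D] using hy
  have key : ∀ j : Fin d', ∃ p : MvPolynomial ℝ ℝ, ∀ S : X,
      |w S.1 j - MvPolynomial.eval (fun y => D y S) p| ≤ ε := by
    intro j
    let f : C(X, ℝ) := ⟨fun S => w S.1 j, by
      have := hwX.domRestrict
      exact (continuous_apply j).comp this⟩
    have hf : f ∈ A.topologicalClosure := by rw [hA]; trivial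
    obtain ⟨g, hg, hfg⟩ := Metric.mem_closure_iff.1 hf ε hε
    have hg' : g ∈ (MvPolynomial.aeval D : MvPolynomial ℝ ℝ →ₐ[ℝ] C(X, ℝ)).range := by
      rw [← Algebra.adjoin_range_eq_range_aeval]; exact hg
    obtain ⟨p, rfl⟩ := hg'
    refine ⟨p, fun S => ?_⟩
    have := (ContinuousMap.dist_apply_le_dist (f := f) S).trans hfg.le
    rw [Real.dist_eq] at this
    have heq : MvPolynomial.eval (fun y => D y S) p = (MvPolynomial.aeval D p : C(X, ℝ)) S := by
      clear this hfg hg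
      induction p using MvPolynomial.induction_on with
      | C a => simp [Algebra.algebraMap_eq_smul_one]
      | add p q hp hq => simp only [map_add, ContinuousMap.add_apply, hp, hq]
      | mul_X p i hp => simp only [map_mul, ContinuousMap.mul_apply, hp, MvPolynomial.eval_X,
          MvPolynomial.aeval_X]
    rw [heq]; exact this
  choose p hp using key
  let T : Finset ℝ := insert 0 (Finset.univ.biUnion fun j => (p j).vars)
  let e : T ≃ Fin (Fintype.card T) := Fintype.equivFin T
  refine ⟨Fintype.card T, Fintype.card_pos_iff.2 ⟨⟨0, Finset.mem_insert_self _ _⟩⟩,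
    fun c => (e.symm c).1,
    fun u j => MvPolynomial.eval (fun y => if h : y ∈ T then u (e ⟨y, h⟩) else 0) (p j), ?_, ?_⟩
  · refine continuous_pi fun j => (MvPolynomial.continuous_eval (p j)).comp ?_
    refine continuous_pi fun y => ?_
    split_ifs <;> fun_prop
  · intro x hx j
    have := hp j ⟨r x, ⟨x, fun i _ => hx i, rfl⟩⟩
    convert this using 3
    refine MvPolynomial.eval₂Hom_congr' rfl ?_ rfl
    intro y hy _
    have hyT : y ∈ T := Finset.mem_insert_of_mem (Finset.mem_biUnion.2 ⟨j, Finset.mem_univ _, hy⟩)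
    have := pn_sup hN x y
    simp only [hyT, dif_pos, Equiv.symm_apply_apply]
    change _ = - Metric.infDist y (Set.range x)
    rw [this, neg_neg]

/-- Universal approximation by PointNet networks `x ↦ ψ(max_i φ(x_i))` (componentwise
max-pooling) of functions `w` defined on nonempty subsets of a compact `K ⊆ ℝ` with at most
`N` elements that are continuous for the Hausdorff distance, for a continuous, bounded and
non-constant activation `ρ`.  Sets are encoded as elements of the metric space
`NonemptyCompacts ℝ`, whose distance is the Hausdorff distance. -/
theorem pointnet_universal_approximation
    {d' N : ℕ} (hd' : 0 < d') (hN : 0 < N)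
    (ρ : ℝ → ℝ) (hρ_cont : Continuous ρ) (hρ_bdd : ∃ C, ∀ x, |ρ x| ≤ C)
    (hρ_nonconst : ∃ x y, ρ x ≠ ρ y)
    (K : Set ℝ) (hK : IsCompact K)
    (w : TopologicalSpace.NonemptyCompacts ℝ → (Fin d' → ℝ))
    (hw : ContinuousOn w
      {S : TopologicalSpace.NonemptyCompacts ℝ | (S : Set ℝ) ⊆ K ∧ (S : Set ℝ).ncard ≤ N}) :
    ∀ ε > (0 : ℝ),
      ∃ (k : ℕ), 0 < k ∧
      ∃ (φ : (Fin 1 → ℝ) → (Fin k → ℝ)) (ψ : (Fin k → ℝ) → (Fin d' → ℝ)),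
        IsNeuralNet ρ 1 k φ ∧ IsNeuralNet ρ k d' ψ ∧
        ∀ x : Fin N → ℝ, (∀ i, x i ∈ K) →
          ‖w ⟨⟨Set.range x, (Set.finite_range x).isCompact⟩,
                ⟨x ⟨0, hN⟩, ⟨⟨0, hN⟩, rfl⟩⟩⟩
            - ψ (fun c => ⨆ i, φ (fun _ => x i) c)‖ ≤ ε := by
  intro ε hε
  obtain ⟨k, hk, y, P, hP, hPw⟩ := pn_step hN K hK w hw (ε / 3) (by positivity)
  -- compact box containing the pooled features
  obtain ⟨M, hM⟩ : ∃ M : ℝ, ∀ t ∈ K, ∀ c, |t - y c| ≤ M := by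
    obtain ⟨M0, hM0⟩ := hK.isBounded.exists_norm_le
    refine ⟨M0 + ∑ c, |y c|, fun t ht c => ?_⟩
    have h1 := hM0 t ht
    rw [Real.norm_eq_abs] at h1
    have h2 := Finset.single_le_sum (f := fun c => |y c|) (fun c _ => abs_nonneg _)
      (Finset.mem_univ c)
    have h3 := abs_sub t (y c)
    linarith
  let B : Set (Fin k → ℝ) := Set.univ.pi fun _ => Set.Icc (-(|M| + 1)) (|M| + 1)
  have hB : IsCompact B := isCompact_univ_pi fun _ => isCompact_Icc
  obtain ⟨ψ, hψ, hψP⟩ := pn_uat ρ hρ_cont hρ_bdd hρ_nonconst B hB P hP (ε / 3) (by positivity)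
  have huc := hB.uniformContinuousOn_of_continuous hP.continuousOn
  obtain ⟨δ, hδ, hδP⟩ := Metric.uniformContinuousOn_iff.1 huc (ε / 3) (by positivity)
  have hK1 : IsCompact (Set.univ.pi fun _ : Fin 1 => K) := isCompact_univ_pi fun _ => hK
  have hη : 0 < min (δ / 2) 1 := by positivity
  obtain ⟨φ, hφ, hφF⟩ := pn_uat ρ hρ_cont hρ_bdd hρ_nonconst _ hK1
    (fun t (c : Fin k) => -|t 0 - y c|) (by fun_prop) (min (δ / 2) 1) hη
  refine ⟨k, hk, φ, ψ, hφ, hψ, fun x hx => ?_⟩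
  rw [pi_norm_le_iff_of_nonneg hε.le]
  intro j
  set u : Fin k → ℝ := fun c => ⨆ i, -|x i - y c| with hu
  set v : Fin k → ℝ := fun c => ⨆ i, φ (fun _ => x i) c with hv
  have huv : ∀ c, |u c - v c| ≤ min (δ / 2) 1 := fun c =>
    pn_sup_close hN _ _ _ fun i => hφF (fun _ => x i) (fun _ _ => hx i) c
  have hNe : Nonempty (Fin N) := ⟨⟨0, hN⟩⟩
  have hub : ∀ c, |u c| ≤ |M| := by
    intro c
    have := pn_sup_close hN (fun i => -|x i - y c|) (fun _ => 0) |M| (fun i => by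
      simp only [sub_zero, abs_neg, abs_abs]
      exact (hM _ (hx i) c).trans (le_abs_self M))
    simpa using this
  have huB : u ∈ B := fun c _ => by
    have := abs_le.1 (hub c)
    constructor <;> linarith
  have hvB : v ∈ B := fun c _ => by
    have h1 := abs_le.1 (hub c)
    have h2 := abs_le.1 ((huv c).trans (min_le_right _ _))
    constructor <;> linarith
  have hd : dist u v < δ := by
    refine lt_of_le_of_lt ((dist_pi_le_iff (by positivity : 0 ≤ δ / 2)).2 fun c => ?_)
      (by linarith : δ / 2 < δ)
    rw [Real.dist_eq]
    exact (huv c).trans (min_le_left _ _)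
  have e1 := hPw x hx j
  have e2 := ((dist_le_pi_dist (P u) (P v) j).trans (hδP u huB v hvB hd).le)
  have e3 := hψP v hvB j
  rw [Real.dist_eq] at e2
  rw [Pi.sub_apply, Real.norm_eq_abs]
  rw [← hu] at e1
  rw [abs_le] at *
  constructor <;> linarith [e1.1, e1.2, e2.1, e2.2, e3.1, e3.2]
end

section
/- Let κ, q, η, c > 0 with q² ≤ η, T > 0, and set Δ = (κ + q)² + η − q² (so Δ > 0). Define K : [0,T] → ℝ by K(t) = −(1/2) [ κ + q − √Δ · ( √Δ sinh(√Δ (T − t)) + (κ + q + c) cosh(√Δ (T − t)) ) / ( √Δ cosh(√Δ (T − t)) + (κ + q + c) sinh(√Δ (T − t)) ) ]. Then the denominator √Δ cosh(√Δ (T − t)) + (κ + q + c) sinh(√Δ (T − t)) is strictly positive for all t ∈ [0,T], K(T) = c/2, and K satisfies the Riccati ordinary differential equation K'(t) = 2 K(t)² + 2(κ + q) K(t) − (η − q²)/2 for all t ∈ [0,T]. -/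
/-- The Riccati function `K` giving the explicit solution of the Bellman equation for the
linear-quadratic mean-field systemic risk problem: with `Δ = (κ+q)² + η - q² > 0`, the
denominator `√Δ cosh(√Δ(T-t)) + (κ+q+c) sinh(√Δ(T-t))` is positive on `[0,T]`,
`K(T) = c/2`, and `K` satisfies the Riccati ODE
`K'(t) = 2 K(t)² + 2(κ+q) K(t) - (η - q²)/2` on `[0,T]`. -/
theorem systemic_risk_riccati
    (κ q η c T : ℝ) (hκ : 0 < κ) (hq : 0 < q) (hη : 0 < η) (hc : 0 < c)
    (hqη : q ^ 2 ≤ η) (hT : 0 < T)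
    (Δ : ℝ) (hΔ : Δ = (κ + q) ^ 2 + η - q ^ 2)
    (K : ℝ → ℝ)
    (hK : ∀ t, K t = -(1 / 2) * (κ + q - Real.sqrt Δ *
      ((Real.sqrt Δ * Real.sinh (Real.sqrt Δ * (T - t))
          + (κ + q + c) * Real.cosh (Real.sqrt Δ * (T - t))) /
        (Real.sqrt Δ * Real.cosh (Real.sqrt Δ * (T - t))
          + (κ + q + c) * Real.sinh (Real.sqrt Δ * (T - t)))))) :
    0 < Δ ∧
    (∀ t ∈ Set.Icc (0 : ℝ) T,
      0 < Real.sqrt Δ * Real.cosh (Real.sqrt Δ * (T - t))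
          + (κ + q + c) * Real.sinh (Real.sqrt Δ * (T - t))) ∧
    K T = c / 2 ∧
    (∀ t ∈ Set.Icc (0 : ℝ) T,
      HasDerivAt K (2 * K t ^ 2 + 2 * (κ + q) * K t - (η - q ^ 2) / 2) t) := by
  have hpos : 0 < Δ := by rw [hΔ]; nlinarith [mul_pos hκ hq, sq_nonneg (κ + q), pow_pos hκ 2, pow_pos hq 2]
  have hs : 0 < Real.sqrt Δ := Real.sqrt_pos.mpr hpos
  have hs2 : Real.sqrt Δ ^ 2 = (κ + q) ^ 2 + η - q ^ 2 := by rw [Real.sq_sqrt hpos.le, hΔ]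
  generalize Real.sqrt Δ = s at *
  have hD : ∀ t ∈ Set.Icc (0 : ℝ) T,
      0 < s * Real.cosh (s * (T - t)) + (κ + q + c) * Real.sinh (s * (T - t)) := by
    intro t ht
    have h1 : 0 ≤ Real.sinh (s * (T - t)) :=
      Real.sinh_nonneg_iff.mpr (mul_nonneg hs.le (by linarith [ht.2]))
    have h2 := Real.cosh_pos (s * (T - t))
    positivity
  refine ⟨hpos, hD, ?_, ?_⟩
  · rw [hK]
    simp
    field_simp
    ring
  · intro t ht
    have hd := (hD t ht).ne'
    have hl : HasDerivAt (fun t : ℝ => s * (T - t)) (-s) t := by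
      simpa using ((hasDerivAt_id t).const_sub T).const_mul s
    have hN := (hl.sinh.const_mul s).add (hl.cosh.const_mul (κ + q + c))
    have hDD := (hl.cosh.const_mul s).add (hl.sinh.const_mul (κ + q + c))
    have hR := ((((hN.div hDD hd).const_mul s).const_sub (κ + q)).const_mul (-(1 / 2)))
    have hKf : K = _ := funext hK
    rw [hK t]
    rw [hKf]
    refine hR.congr_deriv ?_
    have e : η - q ^ 2 = s ^ 2 - (κ + q) ^ 2 := by linarith
    rw [e]
    simp only [Pi.add_apply]
    generalize Real.cosh (s * (T - t)) = C at *
    generalize Real.sinh (s * (T - t)) = S at *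
    field_simp
    ring
end

section
/- Let κ, q, η, c > 0 with q² ≤ η, T > 0, set Δ = (κ + q)² + η − q², and let K : [0,T] → ℝ be defined by K(t) = −(1/2) [ κ + q − √Δ · ( √Δ sinh(√Δ (T − t)) + (κ + q + c) cosh(√Δ (T − t)) ) / ( √Δ cosh(√Δ (T − t)) + (κ + q + c) sinh(√Δ (T − t)) ) ]. Define I : [0,T] → ℝ by I(t) = (1/2) ln[ cosh(√Δ (T − t)) + ((κ + q + c)/√Δ) sinh(√Δ (T − t)) ] − (1/2)(κ + q)(T − t). Then I(T) = 0 and I'(t) = −K(t) for all t ∈ [0,T]; consequently ∫_t^T K(s) ds = I(t) for all t ∈ [0,T]. -/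
/-- Closed form of `∫_t^T K(s) ds` for the Riccati function `K` of the linear-quadratic
mean-field systemic risk problem: with `Δ = (κ+q)² + η - q²` and
`I(t) = (1/2) ln[cosh(√Δ(T-t)) + ((κ+q+c)/√Δ) sinh(√Δ(T-t))] - (1/2)(κ+q)(T-t)`,
one has `I(T) = 0`, `I' = -K` on `[0,T]`, and hence `∫_t^T K(s) ds = I(t)` on `[0,T]`. -/
theorem systemic_risk_riccati_integral
    (κ q η c T : ℝ) (hκ : 0 < κ) (hq : 0 < q) (hη : 0 < η) (hc : 0 < c)
    (hqη : q ^ 2 ≤ η) (hT : 0 < T)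
    (Δ : ℝ) (hΔ : Δ = (κ + q) ^ 2 + η - q ^ 2)
    (K : ℝ → ℝ)
    (hK : ∀ t, K t = -(1 / 2) * (κ + q - Real.sqrt Δ *
      ((Real.sqrt Δ * Real.sinh (Real.sqrt Δ * (T - t))
          + (κ + q + c) * Real.cosh (Real.sqrt Δ * (T - t))) /
        (Real.sqrt Δ * Real.cosh (Real.sqrt Δ * (T - t))
          + (κ + q + c) * Real.sinh (Real.sqrt Δ * (T - t))))))
    (I : ℝ → ℝ)
    (hI : ∀ t, I t = (1 / 2) * Real.log (Real.cosh (Real.sqrt Δ * (T - t))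
          + ((κ + q + c) / Real.sqrt Δ) * Real.sinh (Real.sqrt Δ * (T - t)))
        - (1 / 2) * (κ + q) * (T - t)) :
    I T = 0 ∧
    (∀ t ∈ Set.Icc (0 : ℝ) T, HasDerivAt I (-K t) t) ∧
    (∀ t ∈ Set.Icc (0 : ℝ) T, ∫ s in t..T, K s = I t) := by
  have hr : 0 < Real.sqrt Δ := by
    apply Real.sqrt_pos.mpr
    rw [hΔ]
    have : 0 < (κ + q) ^ 2 := by positivity
    linarith
  set r := Real.sqrt Δ with hrdef
  clear_value r
  have ha : 0 < κ + q + c := by positivity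
  have hD : ∀ t ≤ T, 0 < r * Real.cosh (r * (T - t)) + (κ + q + c) * Real.sinh (r * (T - t)) := by
    intro t ht
    have h1 := Real.cosh_pos (r * (T - t))
    have h2 : 0 ≤ Real.sinh (r * (T - t)) :=
      Real.sinh_nonneg_iff.mpr (mul_nonneg hr.le (by linarith))
    positivity
  have hder : ∀ t ≤ T, HasDerivAt I (-K t) t := by
    intro t ht
    have hd := hD t ht
    have hlin : HasDerivAt (fun t : ℝ => T - t) (-1) t := by
      simpa using (hasDerivAt_id t).const_sub T
    have hl := hlin.const_mul r
    have hE : Real.cosh (r * (T - t)) + ((κ + q + c) / r) * Real.sinh (r * (T - t))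
        = (r * Real.cosh (r * (T - t)) + (κ + q + c) * Real.sinh (r * (T - t))) / r := by
      field_simp
    have hne : Real.cosh (r * (T - t)) + ((κ + q + c) / r) * Real.sinh (r * (T - t)) ≠ 0 := by
      rw [hE]; positivity
    have hlog := (hl.cosh.add (hl.sinh.const_mul ((κ + q + c) / r))).log hne
    have hfin := (hlog.const_mul (1 / 2)).sub (hlin.const_mul ((1 / 2) * (κ + q)))
    have hIf : I = _ := funext hI
    rw [hIf]
    refine hfin.congr_deriv ?_
    simp only [Pi.add_apply]
    rw [hK, hE]
    have hd' := hd.ne'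
    field_simp
    ring
  have hIT : I T = 0 := by rw [hI]; simp
  refine ⟨hIT, fun t ht => hder t ht.2, fun t ht => ?_⟩
  have hcont : ContinuousOn K (Set.uIcc t T) := by
    rw [Set.uIcc_of_le ht.2, show K = _ from funext hK]
    refine ContinuousOn.mul (by fun_prop) (ContinuousOn.sub (by fun_prop)
      (ContinuousOn.mul (by fun_prop) (ContinuousOn.div ?_ ?_ ?_)))
    · exact Continuous.continuousOn (by fun_prop)
    · exact Continuous.continuousOn (by fun_prop)
    · intro s hs
      exact (hD s hs.2).ne'
  have h := intervalIntegral.integral_eq_sub_of_hasDerivAt (a := t) (b := T) (f := I)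
    (f' := fun s => -K s)
    (fun s hs => hder s (by rw [Set.uIcc_of_le ht.2] at hs; exact hs.2))
    hcont.neg.intervalIntegrable
  rw [intervalIntegral.integral_neg, hIT] at h
  linarith
end
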